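/- Let (N,c,E) be a bankruptcy problem with |N| = n and let v be the associated bankruptcy game. Then the random arrival rule coincides with the Shapley value of the bankruptcy game: for every i ∈ N, (1/n!) Σ_{σ∈Π(N)} x(σ)_i = Σ_{S⊆N∖{i}} [|S|!·(n−|S|−1)!/n!] · ( v(S∪{i}) − v(S) ). -/

import Mathlib

open Finset

/-- The set of predecessors of `i` under the permutation `σ`. -/
def preds {N : Type} [Fintype N] (σ : N ≃ Fin (Fintype.card N)) (i : N) : Finset N :=
  Finset.univ.filter (fun j => σ j < σ i)

/-- The marginal payment `x(σ)_i = min (c i) (max 0 (E - ∑_{j ∈ P_i^σ} c j))`. -/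
noncomputable def payment {N : Type} [Fintype N] (c : N → ℝ) (E : ℝ)
    (σ : N ≃ Fin (Fintype.card N)) (i : N) : ℝ :=
  min (c i) (max 0 (E - ∑ j ∈ preds σ i, c j))

open Numbering in
/-- `P` is the set of predecessors of `i` exactly when `P` is a prefix and `i` comes right
after it. -/
lemma preds_eq_iff {N : Type} [Fintype N] (σ : N ≃ Fin (Fintype.card N)) (i : N) (P : Finset N) :
    preds σ i = P ↔ IsPrefix σ P ∧ (σ i : ℕ) = P.card := by
  have card_preds : (preds σ i).card = (σ i : ℕ) := by
    have h : (preds σ i).map σ.toEmbedding = Finset.Iio (σ i) := by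
      ext k
      simp only [preds, mem_map_equiv, mem_filter, mem_univ, true_and, Equiv.apply_symm_apply,
        mem_Iio]
    rw [← Finset.card_map σ.toEmbedding, h, Fin.card_Iio]
  constructor
  · rintro rfl
    refine ⟨fun x => ?_, card_preds.symm⟩
    rw [card_preds]
    simp [preds]
  · rintro ⟨hP, hi⟩
    ext x
    rw [hP x, ← hi]
    simp [preds]

/-- The number of orderings with a given set of predecessors does not depend on the claimant
outside that set. -/
lemma card_preds_eq_congr {N : Type} [Fintype N] [DecidableEq N] {P : Finset N} {i j : N}
    (hi : i ∉ P) (hj : j ∉ P) :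
    (univ.filter fun σ : N ≃ Fin (Fintype.card N) => preds σ i = P).card =
      (univ.filter fun σ : N ≃ Fin (Fintype.card N) => preds σ j = P).card := by
  refine Finset.card_equiv (Equiv.equivCongr (Equiv.swap i j) (Equiv.refl _)) fun σ => ?_
  simp only [mem_filter, mem_univ, true_and, preds_eq_iff, Numbering.IsPrefix]
  simp only [Equiv.equivCongr_apply_apply, Equiv.symm_swap, Equiv.swap_apply_right,
    Equiv.refl_apply]
  refine and_congr_left fun _ => ?_
  have hswap : ∀ x, Equiv.swap i j x ∈ P ↔ x ∈ P := fun x => by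
    rcases eq_or_ne x i with rfl | hxi
    · simp [hi, hj]
    rcases eq_or_ne x j with rfl | hxj
    · simp [hi, hj]
    rw [Equiv.swap_apply_of_ne_of_ne hxi hxj]
  constructor
  · intro h x
    rw [← hswap, h]
  · intro h x
    rw [← hswap, h, Equiv.swap_apply_self]

open Numbering in
/-- The number of orderings in which `P` is the set of predecessors of `i`. -/
lemma card_preds_eq {N : Type} [Fintype N] [DecidableEq N] {P : Finset N} {i : N} (hi : i ∉ P) :
    (univ.filter fun σ : N ≃ Fin (Fintype.card N) => preds σ i = P).card =
      Nat.factorial P.card * Nat.factorial (Fintype.card N - P.card - 1) := by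
  have hlt : P.card < Fintype.card N := Finset.card_lt_univ_of_notMem hi
  have hsum : (prefixed P).card =
      ∑ j ∈ Pᶜ, (univ.filter fun σ : N ≃ Fin (Fintype.card N) => preds σ j = P).card := by
    rw [Finset.card_eq_sum_card_fiberwise (t := Pᶜ)
      (f := fun σ : Numbering N => σ.symm ⟨P.card, hlt⟩)]
    · refine Finset.sum_congr rfl fun j _ => congrArg Finset.card ?_
      ext σ
      simp only [mem_filter, mem_univ, true_and, mem_prefixed, preds_eq_iff,
        Equiv.symm_apply_eq, Fin.ext_iff, eq_comm (a := P.card)]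
    · intro σ hσ
      have hσ' : IsPrefix σ P := mem_prefixed.1 hσ
      simp [hσ' _]
  rw [Finset.sum_congr rfl fun j hj => card_preds_eq_congr (mem_compl.1 hj) hi, sum_const,
    card_prefixed, card_compl, smul_eq_mul] at hsum
  have hpos : 0 < Fintype.card N - P.card := Nat.sub_pos_of_lt hlt
  rw [← Nat.mul_factorial_pred hpos.ne'] at hsum
  exact Nat.eq_of_mul_eq_mul_left hpos (by rw [← hsum]; ring)

/-- A payment `min a (max 0 b)` is a difference of truncated estates. -/
lemma min_max_zero_eq_sub {a : ℝ} (ha : 0 ≤ a) (b : ℝ) :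
    min a (max 0 b) = max 0 b - max 0 (b - a) := by
  grind

/-- The random arrival rule coincides with the Shapley value of the
associated bankruptcy game `v S = max 0 (E - ∑_{j ∉ S} c j)`: for every `i ∈ N`,
`(1/n!) ∑_{σ ∈ Π(N)} x(σ)_i
  = ∑_{S ⊆ N \ {i}} (|S|! (n - |S| - 1)! / n!) (v (S ∪ {i}) - v S)`. -/
theorem randomArrival_eq_shapley {N : Type} [Fintype N] [DecidableEq N] [Nonempty N]
    (c : N → ℝ) (E : ℝ) (hc : ∀ i, 0 ≤ c i) (hE0 : 0 ≤ E) (hE : E ≤ ∑ j, c j)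
    (v : Finset N → ℝ) (hv : ∀ S : Finset N, v S = max 0 (E - ∑ j ∈ Sᶜ, c j))
    (i : N) :
    (1 / (Nat.factorial (Fintype.card N) : ℝ)) *
        ∑ σ : N ≃ Fin (Fintype.card N), payment c E σ i
      = ∑ S ∈ (Finset.univ.erase i).powerset,
          ((Nat.factorial S.card *
            Nat.factorial (Fintype.card N - S.card - 1) : ℝ) /
            (Nat.factorial (Fintype.card N) : ℝ)) *
          (v (insert i S) - v S) := by
  have hmaps : ∀ σ ∈ (univ : Finset (N ≃ Fin (Fintype.card N))),
      (insert i (preds σ i))ᶜ ∈ (univ.erase i).powerset := fun σ _ => by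
    rw [mem_powerset]
    intro x hx
    simp only [mem_compl, mem_insert, not_or] at hx
    simp [hx.1]
  rw [← Finset.sum_fiberwise_of_maps_to hmaps, Finset.mul_sum]
  refine Finset.sum_congr rfl fun S hS => ?_
  have hiS : i ∉ S := fun h => by simpa using mem_powerset.1 hS h
  have hiP : i ∉ (insert i S)ᶜ := by simp
  have hfib : ∀ σ : N ≃ Fin (Fintype.card N),
      (insert i (preds σ i))ᶜ = S ↔ preds σ i = (insert i S)ᶜ := fun σ => by
    have hip : i ∉ preds σ i := by simp [preds]
    constructor
    · rintro rfl
      ext x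
      by_cases hx : x = i <;> simp [hx, hip]
    · intro h
      rw [h]
      ext x
      by_cases hx : x = i <;> simp [hx, hiS]
  have hpay : ∀ σ ∈ univ.filter fun σ : N ≃ Fin (Fintype.card N) =>
      (insert i (preds σ i))ᶜ = S, payment c E σ i = v (insert i S) - v S := fun σ hσ => by
    have hP := (hfib σ).1 (mem_filter.1 hσ).2
    have hcompl : Sᶜ = insert i (insert i S)ᶜ := by
      ext x
      by_cases hx : x = i <;> simp [hx, hiS]
    rw [payment, hP, min_max_zero_eq_sub (hc i), hv, hv, hcompl, sum_insert hiP]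
    ring_nf
  rw [Finset.sum_congr rfl hpay, sum_const, Finset.filter_congr fun σ _ => hfib σ,
    card_preds_eq hiP]
  have hle : S.card + 1 ≤ Fintype.card N := by
    rw [← card_insert_of_notMem hiS]
    exact card_le_univ _
  rw [card_compl, card_insert_of_notMem hiS,
    show Fintype.card N - (Fintype.card N - (S.card + 1)) - 1 = S.card by omega,
    ← Nat.sub_sub, nsmul_eq_mul]
  push_cast
  ring
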